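/- Let R be an integral domain, Y a Stone space, f : Y → Σ(R) continuous with respect to the Zariski topology, and A = {a ∈ LocallyConstant(Y, R) : a(y) ∈ f(y) for all y ∈ Y} the patch algebra of the patch bundle f. Suppose that for every y ∈ Y, every finitely generated ideal of the ring f(y) is projective as an f(y)-module (i.e., each f(y) is a Prüfer domain). Then A is semihereditary: every finitely generated ideal of A is projective as an A-module. -/

import Mathlib

/-- The Zariski topology on the set of subrings of a commutative ring `R`,
generated by the sets `{S | r ∈ S}` for `r ∈ R`. -/
instance zariskiTopology (R : Type*) [CommRing R] : TopologicalSpace (Subring R) :=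
  TopologicalSpace.generateFrom {U : Set (Subring R) | ∃ r : R, U = {S : Subring R | r ∈ S}}

/-- The patch algebra of a family `f` of subrings of `R` indexed by a topological
space `Y`: the subring of `LocallyConstant Y R` consisting of the locally constant
functions `a` with `a y ∈ f y` for all `y`. -/
def patchAlgebra (Y : Type*) [TopologicalSpace Y] (R : Type*) [CommRing R]
    (f : Y → Subring R) : Subring (LocallyConstant Y R) where
  carrier := {a : LocallyConstant Y R | ∀ y : Y, a y ∈ f y}
  zero_mem' := fun y => by simpa using zero_mem (f y)
  one_mem' := fun y => by simpa using one_mem (f y)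
  add_mem' := fun {a b} ha hb y => by simpa using add_mem (ha y) (hb y)
  mul_mem' := fun {a b} ha hb y => by simpa using mul_mem (ha y) (hb y)
  neg_mem' := fun {a} ha y => by simpa using neg_mem (ha y)

theorem proj_of_matrix {B : Type*} [CommRing B] {n : ℕ} (a : Fin n → B) (M : Fin n → Fin n → B)
    (h1 : ∀ j, ∑ i, M j i * a i = a j)
    (h2 : ∀ c : Fin n → B, ∑ j, c j * a j = 0 → ∀ i, ∑ j, c j * M j i = 0) :
    Module.Projective B (Ideal.span (Set.range a)) := by
  let φ0 : (Fin n → B) →ₗ[B] B := Fintype.linearCombination B a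
  let T : (Fin n → B) →ₗ[B] (Fin n → B) := Fintype.linearCombination B M
  have hr : LinearMap.range φ0 = Ideal.span (Set.range a) := Fintype.range_linearCombination B a
  have hk : LinearMap.ker φ0 ≤ LinearMap.ker T := by
    intro c hc
    rw [LinearMap.mem_ker] at hc ⊢
    ext i
    have := h2 c (by simpa [φ0, Fintype.linearCombination_apply] using hc) i
    simpa [T, Fintype.linearCombination_apply] using this
  have hT : ∀ c, φ0 (T c) = φ0 c := by
    intro c
    simp only [φ0, T, Fintype.linearCombination_apply, Finset.sum_apply, Pi.smul_apply, smul_eq_mul]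
    simp_rw [Finset.sum_mul]
    rw [Finset.sum_comm]
    refine Finset.sum_congr rfl fun j _ => ?_
    rw [← h1 j, Finset.mul_sum]
    refine Finset.sum_congr rfl fun i _ => ?_
    rw [mul_assoc]
  rw [← hr]
  let s : LinearMap.range φ0 →ₗ[B] (Fin n → B) :=
    ((LinearMap.ker φ0).liftQ T hk).comp φ0.quotKerEquivRange.symm.toLinearMap
  refine Module.Projective.of_split s φ0.rangeRestrict ?_
  ext ⟨x, c, rfl⟩
  have : φ0.quotKerEquivRange.symm ⟨φ0 c, c, rfl⟩ = Submodule.Quotient.mk c := by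
    rw [LinearEquiv.symm_apply_eq]; rfl
  simp only [s, LinearMap.comp_apply, LinearEquiv.coe_coe, this]
  exact hT c

theorem matrix_of_proj {B : Type*} [CommRing B] {n : ℕ} (a : Fin n → B)
    (hp : Module.Projective B (Ideal.span (Set.range a))) :
    ∃ M : Fin n → Fin n → B, (∀ j, ∑ i, M j i * a i = a j) ∧
      (∀ i j k, a k * M j i = a j * M k i) ∧ ((∀ k, a k = 0) → ∀ j i, M j i = 0) := by
  have hr : LinearMap.range (Fintype.linearCombination B a) = Ideal.span (Set.range a) :=
    Fintype.range_linearCombination B a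
  rw [← hr] at hp
  obtain ⟨s, hs⟩ := Module.projective_lifting_property
    (Fintype.linearCombination B a).rangeRestrict LinearMap.id (LinearMap.surjective_rangeRestrict _)
  have ha : ∀ j, a j ∈ LinearMap.range (Fintype.linearCombination B a) := fun j => by
    rw [hr]; exact Ideal.subset_span ⟨j, rfl⟩
  refine ⟨fun j => s ⟨a j, ha j⟩, fun j => ?_, fun i j k => ?_, fun h j i => ?_⟩
  · have := congrArg Subtype.val (LinearMap.congr_fun hs ⟨a j, ha j⟩)
    simpa [Fintype.linearCombination_apply] using this
  · have : a k • s ⟨a j, ha j⟩ = a j • s ⟨a k, ha k⟩ := by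
      rw [← map_smul, ← map_smul]
      congr 1
      ext
      simp [mul_comm]
    simpa using congrFun this i
  · have : (⟨a j, ha j⟩ : LinearMap.range (Fintype.linearCombination B a)) = 0 := by
      ext; simpa using h j
    simp only [this, map_zero, Pi.zero_apply]

theorem glue {Y X : Type*} [TopologicalSpace Y] [CompactSpace Y] [T2Space Y]
    [TotallyDisconnectedSpace Y] [Nonempty X] (P : X → Y → Prop)
    (h : ∀ y, ∃ m, ∀ᶠ z in nhds y, P m z) : ∃ M : LocallyConstant Y X, ∀ y, P (M y) y := by
  classical
  have key : ∃ C : Set Y, IsClopen C ∧ Set.univ ⊆ C ∧ ∃ M : LocallyConstant Y X, ∀ y ∈ C, P (M y) y := by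
    refine isCompact_univ.induction_on
      (p := fun s => ∃ C : Set Y, IsClopen C ∧ s ⊆ C ∧
        ∃ M : LocallyConstant Y X, ∀ y ∈ C, P (M y) y) ?_ ?_ ?_ ?_
    · exact ⟨∅, isClopen_empty, le_rfl, LocallyConstant.const Y (Classical.arbitrary X), by simp⟩
    · rintro s t hst ⟨C, hC, h1, h2⟩
      exact ⟨C, hC, hst.trans h1, h2⟩
    · rintro s t ⟨C, hC, hs, M, hM⟩ ⟨D, hD, ht, N, hN⟩
      refine ⟨C ∪ D, hC.union hD, Set.union_subset_union hs ht,
        ⟨fun y => if y ∈ C then M y else N y, ?_⟩, ?_⟩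
      · rw [IsLocallyConstant.iff_eventually_eq]
        intro y
        have hm := (IsLocallyConstant.iff_eventually_eq _).1 M.isLocallyConstant y
        have hn := (IsLocallyConstant.iff_eventually_eq _).1 N.isLocallyConstant y
        by_cases hy : y ∈ C
        · filter_upwards [hm, hC.isOpen.mem_nhds hy] with z hz hz'
          simpa [hy, hz'] using hz
        · filter_upwards [hn, hC.compl.isOpen.mem_nhds hy] with z hz hz'
          have hz'' : z ∉ C := hz'
          simpa [hy, hz''] using hz
      · intro y hy
        by_cases hyC : y ∈ C
        · simpa [hyC] using hM y hyC
        · simpa [hyC] using hN y (hy.resolve_left hyC)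
    · intro y _
      obtain ⟨m, hm⟩ := h y
      obtain ⟨C, ⟨hyC, hC⟩, hCm⟩ := (compact_exists_isClopen_in_isOpen isOpen_interior
        (mem_interior_iff_mem_nhds.2 hm)) |>.imp fun C hC => And.intro (And.intro hC.2.1 hC.1) hC.2.2
      exact ⟨C, mem_nhdsWithin_of_mem_nhds (hC.isOpen.mem_nhds hyC), C, hC, le_rfl,
        LocallyConstant.const Y m, fun z hz => interior_subset (hCm hz)⟩
  obtain ⟨C, -, hC, M, hM⟩ := key
  exact ⟨M, fun y => hM y (hC trivial)⟩

set_option synthInstance.maxHeartbeats 1000000 in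
/-- Let `R` be an integral domain, `Y` a Stone space, `f : Y → Σ(R)` continuous for the
Zariski topology, and `A` the patch algebra of the patch bundle `f`.  If every `f y` is
a Prüfer domain (every finitely generated ideal of `f y` is projective), then `A` is
semihereditary: every finitely generated ideal of `A` is projective. -/
theorem patchAlgebra_semihereditary (R : Type*) [CommRing R] [IsDomain R]
    (Y : Type*) [TopologicalSpace Y] [CompactSpace Y] [T2Space Y]
    [TotallyDisconnectedSpace Y] (f : Y → Subring R) (hf : Continuous f)
    (hpruefer : ∀ (y : Y) (I : Ideal (f y)), I.FG → Module.Projective (f y) I) :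
    ∀ I : Ideal (patchAlgebra Y R f), I.FG → Module.Projective (patchAlgebra Y R f) I := by
  intro I hI
  obtain ⟨n, a, ha⟩ := Submodule.fg_iff_exists_fin_generating_family.1 hI
  have ha' : I = Ideal.span (Set.range a) := ha.symm
  have hloc : ∀ y, ∃ M : Fin n → Fin n → R, ∀ᶠ z in nhds y,
      (∀ j i, M j i ∈ f z) ∧ (∀ j, ∑ i, M j i * (a i).1 z = (a j).1 z) ∧
      (∀ i j k, (a k).1 z * M j i = (a j).1 z * M k i) ∧
      ((∀ k, (a k).1 z = 0) → ∀ j i, M j i = 0) := by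
    intro y
    obtain ⟨M, h1, h2, h3⟩ := matrix_of_proj (fun i => (⟨(a i).1 y, (a i).2 y⟩ : f y))
      (hpruefer y _ (Submodule.fg_span (Set.finite_range _)))
    refine ⟨fun j i => (M j i).1, ?_⟩
    have e1 : ∀ᶠ z in nhds y, ∀ k, (a k).1 z = (a k).1 y :=
      Filter.eventually_all.2 fun k =>
        (IsLocallyConstant.iff_eventually_eq _).1 (a k).1.isLocallyConstant y
    have e2 : ∀ᶠ z in nhds y, ∀ j i, (M j i).1 ∈ f z := by
      refine Filter.eventually_all.2 fun j => Filter.eventually_all.2 fun i => ?_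
      have ho : IsOpen {S : Subring R | (M j i).1 ∈ S} :=
        TopologicalSpace.isOpen_generateFrom_of_mem ⟨_, rfl⟩
      exact (ho.preimage hf).mem_nhds (M j i).2
    filter_upwards [e1, e2] with z hz hz'
    simp only [hz]
    refine ⟨hz', fun j => ?_, fun i j k => ?_, fun h j i => ?_⟩
    · simpa using congrArg Subtype.val (h1 j)
    · exact congrArg Subtype.val (h2 i j k)
    · exact congrArg Subtype.val (h3 (fun k => Subtype.ext (h k)) j i)
  obtain ⟨M, hM⟩ := glue _ hloc
  let N : Fin n → Fin n → patchAlgebra Y R f := fun j i =>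
    ⟨M.map (fun m : Fin n → Fin n → R => m j i), fun y => (hM y).1 j i⟩
  let ev : Y → patchAlgebra Y R f →+* R := fun y =>
    ((Pi.evalRingHom (fun _ : Y => R) y).comp LocallyConstant.coeFnRingHom).comp
      (patchAlgebra Y R f).subtype
  have hev : ∀ b c : patchAlgebra Y R f, (∀ y, ev y b = ev y c) → b = c := fun b c h =>
    Subtype.ext (LocallyConstant.ext h)
  have evN : ∀ y j i, ev y (N j i) = M y j i := fun y j i => rfl
  have eva : ∀ y i, ev y (a i) = (a i).1 y := fun y i => rfl
  rw [ha']
  refine proj_of_matrix a N (fun j => hev _ _ fun y => ?_) (fun c hc i => hev _ _ fun y => ?_)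
  · simp only [map_sum, map_mul, evN, eva]
    exact (hM y).2.1 j
  · have hc' := congrArg (ev y) hc
    simp only [map_sum, map_mul, evN, eva, map_zero] at hc' ⊢
    obtain ⟨-, -, h2, h3⟩ := hM y
    by_cases h0 : ∀ k, (a k).1 y = 0
    · simp [h3 h0]
    · push Not at h0
      obtain ⟨k, hk⟩ := h0
      refine (mul_eq_zero.1 ?_).resolve_left hk
      rw [Finset.mul_sum]
      calc ∑ j, (a k).1 y * (ev y (c j) * M y j i)
          = ∑ j, (ev y (c j) * (a j).1 y) * M y k i := by
            refine Finset.sum_congr rfl fun j _ => ?_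
            linear_combination (ev y (c j)) * h2 i j k
        _ = 0 := by rw [← Finset.sum_mul, hc', zero_mul]
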